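/- Let H be a fixed graph on r vertices, p_0 = (ln n − 2 ln ln n)/m_1(H), and p_2^+ = p_2^+(H). Couple G(H,n,p_0) ⊆ G(H,n,p_2^+) so that every copy of H present in G(H,n,p_0) is present in G(H,n,p_2^+). Then with probability tending to 1 as n → ∞, for every vertex v ∈ [n] there exists at most one copy of H present in G(H,n,p_2^+) that intersects both {v} and SMALL \ {v}. -/

import Mathlib

open Filter

namespace RandomMotif

/-- `G` is a *copy* of `H` in the complete graph on `Fin n`: the image of `H`
under an injection of its vertices into `Fin n`. -/
def IsCopy {k n : ℕ} (H : SimpleGraph (Fin k)) (G : SimpleGraph (Fin n)) : Prop :=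
  ∃ f : Fin k ↪ Fin n, G = H.map f

/-- The type of copies of `H` in `K_n`. -/
abbrev Copy {k : ℕ} (H : SimpleGraph (Fin k)) (n : ℕ) : Type :=
  {G : SimpleGraph (Fin n) // IsCopy H G}

/-- The graph spanned by the selected copies. -/
noncomputable def graphOf {k n : ℕ} {H : SimpleGraph (Fin k)} (ω : Copy H n → Bool) :
    SimpleGraph (Fin n) :=
  ⨆ c : Copy H n, if ω c then c.1 else ⊥

open Classical in
/-- The probability, in the binomial random motif model `G(H,n,p)` (each copy of `H`
in `K_n` is included independently with probability `p`), of the event `P` on the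
family of selected copies. -/
noncomputable def selProb {k : ℕ} (H : SimpleGraph (Fin k)) (n : ℕ) (p : ℝ)
    (P : (Copy H n → Bool) → Prop) : ℝ :=
  ∑ ω : Copy H n → Bool,
    (∏ c : Copy H n, if ω c then p else 1 - p) * (if P ω then 1 else 0)

/-- The probability that `G(H,n,p)` satisfies the graph predicate `Q`. -/
noncomputable def motifProb {k : ℕ} (H : SimpleGraph (Fin k)) (n : ℕ) (p : ℝ)
    (Q : SimpleGraph (Fin n) → Prop) : ℝ :=
  selProb H n p (fun ω => Q (graphOf ω))

/-- `mr H n r` is the number of copies of `H` in `K_n` whose vertex set meets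
`[r] = {0,…,r-1}`. -/
noncomputable def mr {k : ℕ} (H : SimpleGraph (Fin k)) (n r : ℕ) : ℕ :=
  Nat.card {G : SimpleGraph (Fin n) // IsCopy H G ∧ ∃ v ∈ G.support, (v : ℕ) < r}

/-- The minimum degree `δ(H)`. -/
noncomputable def minDeg {k : ℕ} (H : SimpleGraph (Fin k)) : ℕ :=
  ⨅ v, (H.neighborSet v).ncard

/-- `δ_d(H) = ⌈d / δ(H)⌉ - 1`. -/
noncomputable def deltad {k : ℕ} (H : SimpleGraph (Fin k)) (d : ℕ) : ℕ :=
  ⌈(d : ℝ) / (minDeg H : ℝ)⌉₊ - 1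

/-- `p_d^-(H) = (ln n + δ_d(H) ln ln n - x(n)) / m_1(H)`, where `x` is a fixed
function with `1 ≪ x(n) ≪ ln ln n`. -/
noncomputable def pMinus {k : ℕ} (H : SimpleGraph (Fin k)) (d : ℕ) (x : ℕ → ℝ) (n : ℕ) : ℝ :=
  (Real.log n + (deltad H d) * Real.log (Real.log n) - x n) / (mr H n 1)

/-- `p_d^+(H) = (ln n + δ_d(H) ln ln n + x(n)) / m_1(H)`, where `x` is a fixed
function with `1 ≪ x(n) ≪ ln ln n`. -/
noncomputable def pPlus {k : ℕ} (H : SimpleGraph (Fin k)) (d : ℕ) (x : ℕ → ℝ) (n : ℕ) : ℝ :=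
  (Real.log n + (deltad H d) * Real.log (Real.log n) + x n) / (mr H n 1)

/-- The number of selected copies of `H` containing the vertex `v`. -/
noncomputable def copyCount {k n : ℕ} {H : SimpleGraph (Fin k)}
    (ω : Copy H n → Bool) (v : Fin n) : ℕ :=
  Nat.card {c : Copy H n // ω c = true ∧ v ∈ c.1.support}

/-- `SMALL`: the set of vertices lying on fewer than `ln ln n` of the selected
copies of `H`. -/
noncomputable def Small {k n : ℕ} {H : SimpleGraph (Fin k)}
    (ω : Copy H n → Bool) : Set (Fin n) :=
  {v : Fin n | (copyCount ω v : ℝ) < Real.log (Real.log n)}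

/-- `LARGE`: the set of vertices lying on at least `ln ln n` of the selected
copies of `H`. -/
noncomputable def Large {k n : ℕ} {H : SimpleGraph (Fin k)}
    (ω : Copy H n → Bool) : Set (Fin n) :=
  {v : Fin n | Real.log (Real.log n) ≤ (copyCount ω v : ℝ)}

/-- `p_0 = (ln n - 2 ln ln n) / m_1(H)`. -/
noncomputable def pZero {k : ℕ} (H : SimpleGraph (Fin k)) (n : ℕ) : ℝ :=
  (Real.log n - 2 * Real.log (Real.log n)) / (mr H n 1)

/-- The joint law of a single copy under the monotone coupling of `G(H,n,p)` and
`G(H,n,q)` (for `p ≤ q`): the first component is the indicator that the copy is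
present in `G(H,n,p)`, the second that it is present in `G(H,n,q)`, and the first
implies the second almost surely. -/
noncomputable def pairWeight (p q : ℝ) : Bool × Bool → ℝ
  | (true, true) => p
  | (false, true) => q - p
  | (false, false) => 1 - q
  | (true, false) => 0

open Classical in
/-- The probability, under the (independent over copies) monotone coupling of
`G(H,n,p) ⊆ G(H,n,q)`, of the event `P` on the pair of selections. -/
noncomputable def coupleProb {k : ℕ} (H : SimpleGraph (Fin k)) (n : ℕ) (p q : ℝ)
    (P : (Copy H n → Bool) → (Copy H n → Bool) → Prop) : ℝ :=
  ∑ ω : Copy H n → Bool × Bool,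
    (∏ c : Copy H n, pairWeight p q (ω c)) *
      (if P (fun c => (ω c).1) (fun c => (ω c).2) then 1 else 0)

section ProductWeights

variable {ι : Type*} [Fintype ι] [DecidableEq ι]

lemma pairWeight_nonneg {p q : ℝ} (hp : 0 ≤ p) (hpq : p ≤ q) (hq : q ≤ 1) (a : Bool × Bool) :
    0 ≤ pairWeight p q a := by
  rcases a with ⟨_ | _, _ | _⟩ <;> simp [pairWeight] <;> linarith

lemma sum_prod_pairWeight (p q : ℝ) (φ : ι → Bool × Bool → ℝ) :
    ∑ ω : ι → Bool × Bool, (∏ c, pairWeight p q (ω c)) * ∏ c, φ c (ω c) =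
      ∏ c, ∑ a, pairWeight p q a * φ c a := by
  simp_rw [← Finset.prod_mul_distrib]
  exact (Fintype.prod_sum fun c a => pairWeight p q a * φ c a).symm

lemma sum_pairWeight (p q : ℝ) :
    ∑ ω : ι → Bool × Bool, ∏ c, pairWeight p q (ω c) = 1 := by
  have h := sum_prod_pairWeight (ι := ι) p q fun _ _ => 1
  simpa [Fintype.sum_prod_type, pairWeight] using h

/-- The indicator that all copies in `D` are present in the larger selection, damped by
`exp (-1)` for each copy in `U` present in the smaller selection. -/
noncomputable def damping (D U : Finset ι) (c : ι) (a : Bool × Bool) : ℝ :=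
  (if c ∈ D then (if a.2 then 1 else 0) else 1) *
    (if c ∈ U then (if a.1 then Real.exp (-1) else 1) else 1)

omit [Fintype ι] in
lemma damping_nonneg (D U : Finset ι) (c : ι) (a : Bool × Bool) : 0 ≤ damping D U c a := by
  unfold damping; positivity

lemma prod_damping (D U : Finset ι) (ω : ι → Bool × Bool) (hD : ∀ c ∈ D, (ω c).2 = true) :
    ∏ c, damping D U c (ω c) = Real.exp (-({c ∈ U | (ω c).1 = true}.card : ℝ)) := by
  have h : ∀ c, damping D U c (ω c) =
      if c ∈ {c ∈ U | (ω c).1 = true} then Real.exp (-1) else 1 := by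
    intro c
    unfold damping
    by_cases h₁ : c ∈ D <;> by_cases h₂ : c ∈ U <;> simp [h₁, h₂, hD]
  simp_rw [h]
  rw [Finset.prod_ite_mem, Finset.univ_inter, Finset.prod_const, ← Real.exp_nat_mul]
  simp

lemma sum_damping_le {p q : ℝ} (hp : 0 ≤ p) (hpq : p ≤ q) (hq : q ≤ 1) (D U : Finset ι) :
    ∑ ω : ι → Bool × Bool, (∏ c, pairWeight p q (ω c)) * ∏ c, damping D U c (ω c) ≤
      q ^ D.card * Real.exp (-((1 - Real.exp (-1)) * p * ((U.card : ℝ) - D.card))) := by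
  have he : Real.exp (-1) ≤ 1 := by simp
  have he0 := (Real.exp_pos (-1)).le
  rw [sum_prod_pairWeight]
  have hle : ∀ c, ∑ a, pairWeight p q a * damping D U c a ≤
      (if c ∈ D then q else 1) *
        (if c ∈ U \ D then Real.exp (-((1 - Real.exp (-1)) * p)) else 1) := by
    intro c
    have := Real.add_one_le_exp (-((1 - Real.exp (-1)) * p))
    by_cases h₁ : c ∈ D <;> by_cases h₂ : c ∈ U <;>
      simp [Fintype.sum_prod_type, pairWeight, damping, h₁, h₂] <;> nlinarith
  refine (Finset.prod_le_prod (fun c _ => Finset.sum_nonneg fun a _ =>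
    mul_nonneg (pairWeight_nonneg hp hpq hq a) (damping_nonneg D U c a)) fun c _ => hle c).trans ?_
  rw [Finset.prod_mul_distrib, Finset.prod_ite_mem, Finset.prod_ite_mem, Finset.univ_inter,
    Finset.univ_inter, Finset.prod_const, Finset.prod_const, ← Real.exp_nat_mul]
  have hcard : (U.card : ℝ) - D.card ≤ (U \ D).card := by
    rw [sub_le_iff_le_add]
    exact_mod_cast Finset.card_le_card_sdiff_add_card
  have hθ : 0 ≤ (1 - Real.exp (-1)) * p := mul_nonneg (by linarith) hp
  have hq0 : 0 ≤ q := hp.trans hpq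
  gcongr
  nlinarith

end ProductWeights

section Counting

open Classical in
/-- The copies of `H` containing the vertex `v`. -/
noncomputable def copiesAt {k : ℕ} (H : SimpleGraph (Fin k)) {n : ℕ} (v : Fin n) :
    Finset (Copy H n) :=
  {c | v ∈ c.1.support}

variable {k n : ℕ} {H : SimpleGraph (Fin k)}

@[simp] lemma mem_copiesAt {v : Fin n} {c : Copy H n} :
    c ∈ copiesAt H v ↔ v ∈ c.1.support := by
  simp [copiesAt]

lemma mem_support_map {V W : Type*} (G : SimpleGraph V) (f : V ↪ W) (v : V) :
    f v ∈ (G.map f).support ↔ v ∈ G.support := by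
  simp only [SimpleGraph.mem_support, SimpleGraph.map_adj]
  constructor
  · rintro ⟨_, a, b, hab, ha, rfl⟩
    exact ⟨b, f.injective ha ▸ hab⟩
  · rintro ⟨w, hw⟩
    exact ⟨f w, v, w, hw, rfl, rfl⟩

/-- The action of a permutation of the vertices on the copies of `H`. -/
noncomputable def permCopy (σ : Equiv.Perm (Fin n)) (c : Copy H n) : Copy H n :=
  ⟨c.1.map σ.toEmbedding, by
    obtain ⟨f, hf⟩ := c.2
    exact ⟨f.trans σ.toEmbedding, by rw [hf, SimpleGraph.map_map]; rfl⟩⟩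

lemma permCopy_injective (σ : Equiv.Perm (Fin n)) :
    Function.Injective (permCopy (H := H) σ) := fun _ _ h =>
  Subtype.ext (SimpleGraph.map_injective _ (congrArg Subtype.val h))

lemma mem_support_permCopy (σ : Equiv.Perm (Fin n)) (c : Copy H n) (v : Fin n) :
    σ v ∈ (permCopy σ c).1.support ↔ v ∈ c.1.support :=
  mem_support_map _ σ.toEmbedding v

lemma card_copiesAt_le (u v : Fin n) : (copiesAt H u).card ≤ (copiesAt H v).card := by
  refine Finset.card_le_card_of_injOn (permCopy (Equiv.swap u v)) (fun c hc => ?_)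
    (permCopy_injective _).injOn
  have := (mem_support_permCopy (Equiv.swap u v) c u).2 (by simpa using hc)
  simpa using this

lemma card_copiesAt_eq_mr (v : Fin n) : (copiesAt H v).card = mr H n 1 := by
  have hn : 0 < n := v.pos
  rw [(card_copiesAt_le v ⟨0, hn⟩).antisymm (card_copiesAt_le _ _), mr, ← Fintype.card_coe,
    ← Nat.card_eq_fintype_card]
  refine Nat.card_congr (.trans (.subtypeEquivRight fun c => mem_copiesAt) <|
    (Equiv.subtypeSubtypeEquivSubtypeInter (IsCopy H) fun G => (⟨0, hn⟩ : Fin n) ∈ G.support).trans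
    (.subtypeEquivRight fun G => and_congr_right fun _ => ⟨fun h => ⟨_, h, one_pos⟩, ?_⟩))
  rintro ⟨w, hw, hw1⟩
  rwa [show (⟨0, hn⟩ : Fin n) = w from Fin.ext (by simpa using (Nat.lt_one_iff.1 hw1).symm)]

open Classical in
lemma card_copiesAt_inter_le {u v w : Fin n} (huv : u ≠ v) (huw : u ≠ w) :
    (copiesAt H u ∩ copiesAt H v).card ≤ (copiesAt H u ∩ copiesAt H w).card := by
  refine Finset.card_le_card_of_injOn (permCopy (Equiv.swap v w)) (fun c hc => ?_)
    (permCopy_injective _).injOn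
  simp only [Finset.coe_inter, Set.mem_inter_iff, Finset.mem_coe, mem_copiesAt] at hc ⊢
  have h₁ := (mem_support_permCopy (Equiv.swap v w) c u).2 hc.1
  have h₂ := (mem_support_permCopy (Equiv.swap v w) c v).2 hc.2
  rw [Equiv.swap_apply_of_ne_of_ne huv huw] at h₁
  rw [Equiv.swap_apply_left] at h₂
  exact ⟨h₁, h₂⟩

lemma support_map_eq_range (hiso : ∀ v, (H.neighborSet v).Nonempty) (f : Fin k ↪ Fin n) :
    (H.map f).support = Set.range f := by
  ext v
  constructor
  · rintro ⟨w, hw⟩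
    obtain ⟨a, b, -, rfl, -⟩ := (SimpleGraph.map_adj _ _ _ _).1 hw
    exact ⟨a, rfl⟩
  · rintro ⟨a, rfl⟩
    exact (mem_support_map H f a).2 (hiso a)

open Classical in
lemma card_support_copy (hiso : ∀ v, (H.neighborSet v).Nonempty) (c : Copy H n) :
    ({v : Fin n | v ∈ c.1.support} : Finset (Fin n)).card = k := by
  obtain ⟨f, hf⟩ := c.2
  have : ({v : Fin n | v ∈ c.1.support} : Finset (Fin n)) = Finset.univ.map f := by
    ext v
    simp [hf, support_map_eq_range hiso]
  rw [this]
  simp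

open Classical in
lemma pred_mul_card_copiesAt_inter (hiso : ∀ v, (H.neighborSet v).Nonempty) {u v : Fin n}
    (huv : u ≠ v) :
    (n - 1) * (copiesAt H u ∩ copiesAt H v).card = (k - 1) * mr H n 1 := by
  have h₁ : ∑ w ∈ Finset.univ.erase u, (copiesAt H u ∩ copiesAt H w).card =
      (n - 1) * (copiesAt H u ∩ copiesAt H v).card := by
    rw [Finset.sum_const_nat (m := (copiesAt H u ∩ copiesAt H v).card)]
    · simp
    · intro w hw
      have huw := (Finset.ne_of_mem_erase hw).symm
      exact (card_copiesAt_inter_le huw huv).antisymm (card_copiesAt_inter_le huv huw)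
  have h₂ : ∀ c ∈ copiesAt H u,
      ((Finset.univ.erase u).filter fun w => w ∈ c.1.support).card = k - 1 := by
    intro c hc
    rw [Finset.filter_erase, Finset.card_erase_of_mem (by simpa using hc),
      card_support_copy hiso]
  rw [← h₁, ← card_copiesAt_eq_mr (H := H) u, mul_comm, ← Finset.sum_const_nat h₂]
  simp_rw [Finset.card_eq_sum_ones, Finset.sum_filter]
  rw [Finset.sum_comm]
  refine Finset.sum_congr rfl fun w _ => ?_
  rw [← Finset.sum_filter]
  congr 1
  ext c
  simp

lemma two_le_of_forall_neighborSet_nonempty (hk : 0 < k)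
    (hiso : ∀ v, (H.neighborSet v).Nonempty) : 2 ≤ k := by
  obtain ⟨w, hw⟩ := hiso ⟨0, hk⟩
  have h : (⟨0, hk⟩ : Fin k) ≠ w := SimpleGraph.Adj.ne hw
  have : (0 : ℕ) ≠ w := fun h' => h (Fin.ext h')
  omega

lemma pred_le_mul_mr (hk : 0 < k) (hiso : ∀ v, (H.neighborSet v).Nonempty) (hkn : k ≤ n) :
    n - 1 ≤ (k - 1) * mr H n 1 := by
  classical
  have h2 := two_le_of_forall_neighborSet_nonempty hk hiso
  let f : Fin k ↪ Fin n := Fin.castLEEmb hkn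
  let a : Fin k := ⟨0, by omega⟩
  let b : Fin k := ⟨1, by omega⟩
  have hab : f a ≠ f b := fun h => by simpa [a, b] using f.injective h
  rw [← pred_mul_card_copiesAt_inter hiso hab]
  refine Nat.le_mul_of_pos_right _ (Finset.card_pos.2 ⟨⟨H.map f, f, rfl⟩, ?_⟩)
  simp [support_map_eq_range hiso]

end Counting

section UnionBound

variable {k n : ℕ} {H : SimpleGraph (Fin k)}

lemma coupleProb_le_one {p q : ℝ} (hp : 0 ≤ p) (hpq : p ≤ q) (hq : q ≤ 1)
    (P : (Copy H n → Bool) → (Copy H n → Bool) → Prop) : coupleProb H n p q P ≤ 1 := by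
  classical
  rw [← sum_pairWeight (ι := Copy H n) p q, coupleProb]
  refine Finset.sum_le_sum fun ω _ => mul_le_of_le_one_right
    (Finset.prod_nonneg fun c _ => pairWeight_nonneg hp hpq hq _) ?_
  split_ifs <;> norm_num

lemma copyCount_eq_card (ω : Copy H n → Bool) (v : Fin n) :
    copyCount ω v = {c ∈ copiesAt H v | ω c = true}.card := by
  classical
  rw [copyCount, ← Fintype.card_coe, ← Nat.card_eq_fintype_card]
  exact Nat.card_congr (.subtypeEquivRight fun c => by simp [and_comm])

open Classical in
lemma one_le_of_mem_small {ω : Copy H n → Bool} {u v : Fin n} (hu : u ∈ Small ω)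
    (hv : v ∈ Small ω) :
    1 ≤ Real.exp (2 * Real.log (Real.log n)) *
      Real.exp (-({c ∈ copiesAt H u ∪ copiesAt H v | ω c = true}.card : ℝ)) := by
  rw [← Real.exp_add, Real.one_le_exp_iff]
  have h : ({c ∈ copiesAt H u ∪ copiesAt H v | ω c = true}.card : ℝ) ≤
      copyCount ω u + copyCount ω v := by
    rw [copyCount_eq_card, copyCount_eq_card, Finset.filter_union]
    exact_mod_cast Finset.card_union_le _ _
  simp only [Small, Set.mem_ofPred_eq] at hu hv
  linarith

/-- The bound on the probability that two given copies are present in the larger selection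
while the smaller selection contains few copies out of a given set of `m` copies. -/
noncomputable def pairBound (n : ℕ) (p q m : ℝ) : ℝ :=
  Real.exp (2 * Real.log (Real.log n)) *
    (q ^ 2 * Real.exp (-((1 - Real.exp (-1)) * p * (m - 2))))

lemma pairBound_nonneg (n : ℕ) (p q m : ℝ) : 0 ≤ pairBound n p q m := by
  unfold pairBound; positivity

lemma pairBound_anti {p : ℝ} (hp : 0 ≤ p) (n : ℕ) (q : ℝ) : Antitone (pairBound n p q) := by
  intro m m' h
  have : 0 ≤ 1 - Real.exp (-1) := by simp
  unfold pairBound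
  gcongr

lemma le_sum_of_le_of_mem {ι : Type*} {s : Finset ι} {f : ι → ℝ} {a : ℝ} {i : ι} (hi : i ∈ s)
    (hf : ∀ j, 0 ≤ f j) (h : a ≤ f i) : a ≤ ∑ j ∈ s, f j :=
  h.trans (Finset.single_le_sum (fun j _ => hf j) hi)

/-- Every vertex lies in at most one copy of the larger selection that contains another vertex
which is small in the smaller selection. -/
def SparselyCovered (ω₀ ω₂ : Copy H n → Bool) : Prop :=
  ∀ v : Fin n, {c : Copy H n | ω₂ c = true ∧ v ∈ c.1.support ∧
    ∃ u ∈ Small ω₀, u ≠ v ∧ u ∈ c.1.support}.Subsingleton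

open Classical in
lemma one_le_sum_damping {ω : Copy H n → Bool × Bool}
    (hω : ¬ SparselyCovered (fun c => (ω c).1) fun c => (ω c).2) :
    1 ≤ ∑ v : Fin n, ∑ u₁ ∈ Finset.univ.erase v, ∑ u₂ ∈ Finset.univ.erase v,
      ∑ c₁ ∈ copiesAt H v ∩ copiesAt H u₁, ∑ c₂ ∈ (copiesAt H v ∩ copiesAt H u₂).erase c₁,
        Real.exp (2 * Real.log (Real.log n)) *
          ∏ c, damping {c₁, c₂} (copiesAt H u₁ ∪ copiesAt H u₂) c (ω c) := by
  have hnn : ∀ D U : Finset (Copy H n), 0 ≤ Real.exp (2 * Real.log (Real.log n)) *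
      ∏ c, damping D U c (ω c) := fun D U =>
    mul_nonneg (Real.exp_pos _).le (Finset.prod_nonneg fun c _ => damping_nonneg D U c _)
  simp only [SparselyCovered, Set.Subsingleton, not_forall] at hω
  obtain ⟨v, c₁, ⟨h₁, hv₁, u₁, hu₁, huv₁, huc₁⟩, c₂, ⟨h₂, hv₂, u₂, hu₂, huv₂, huc₂⟩, hne⟩ := hω
  refine le_sum_of_le_of_mem (Finset.mem_univ v) (fun _ => Finset.sum_nonneg fun _ _ =>
    Finset.sum_nonneg fun _ _ => Finset.sum_nonneg fun _ _ => Finset.sum_nonneg fun _ _ =>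
    hnn _ _) ?_
  refine le_sum_of_le_of_mem (Finset.mem_erase.2 ⟨huv₁, Finset.mem_univ u₁⟩) (fun _ =>
    Finset.sum_nonneg fun _ _ => Finset.sum_nonneg fun _ _ => Finset.sum_nonneg fun _ _ =>
    hnn _ _) ?_
  refine le_sum_of_le_of_mem (Finset.mem_erase.2 ⟨huv₂, Finset.mem_univ u₂⟩) (fun _ =>
    Finset.sum_nonneg fun _ _ => Finset.sum_nonneg fun _ _ => hnn _ _) ?_
  refine le_sum_of_le_of_mem (i := c₁) (by simp [hv₁, huc₁]) (fun _ =>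
    Finset.sum_nonneg fun _ _ => hnn _ _) ?_
  refine le_sum_of_le_of_mem (i := c₂) (by simp [hv₂, huc₂, Ne.symm hne]) (fun _ => hnn _ _) ?_
  rw [prod_damping _ _ _ (by simp [h₁, h₂])]
  exact one_le_of_mem_small hu₁ hu₂

open Classical in
lemma one_sub_coupleProb_le {p q : ℝ} (hp : 0 ≤ p) (hpq : p ≤ q) (hq : q ≤ 1) :
    1 - coupleProb H n p q SparselyCovered ≤
      ∑ v : Fin n, ∑ u₁ ∈ Finset.univ.erase v, ∑ u₂ ∈ Finset.univ.erase v,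
        ∑ c₁ ∈ copiesAt H v ∩ copiesAt H u₁, ∑ _c₂ ∈ (copiesAt H v ∩ copiesAt H u₂).erase c₁,
          pairBound n p q (copiesAt H u₁ ∪ copiesAt H u₂).card := by
  rw [← sum_pairWeight (ι := Copy H n) p q, coupleProb, ← Finset.sum_sub_distrib]
  trans ∑ ω : Copy H n → Bool × Bool, (∏ c, pairWeight p q (ω c)) *
    ∑ v : Fin n, ∑ u₁ ∈ Finset.univ.erase v, ∑ u₂ ∈ Finset.univ.erase v,
      ∑ c₁ ∈ copiesAt H v ∩ copiesAt H u₁, ∑ c₂ ∈ (copiesAt H v ∩ copiesAt H u₂).erase c₁,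
        Real.exp (2 * Real.log (Real.log n)) *
          ∏ c, damping {c₁, c₂} (copiesAt H u₁ ∪ copiesAt H u₂) c (ω c)
  · refine Finset.sum_le_sum fun ω _ => ?_
    rw [← mul_one_sub]
    refine mul_le_mul_of_nonneg_left ?_
      (Finset.prod_nonneg fun c _ => pairWeight_nonneg hp hpq hq _)
    split_ifs with h
    · rw [sub_self]
      refine Finset.sum_nonneg fun v _ => Finset.sum_nonneg fun u₁ _ => Finset.sum_nonneg
        fun u₂ _ => Finset.sum_nonneg fun c₁ _ => Finset.sum_nonneg fun c₂ _ =>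
        mul_nonneg (Real.exp_pos _).le (Finset.prod_nonneg fun c _ => damping_nonneg _ _ c _)
    · rw [sub_zero]
      exact one_le_sum_damping h
  simp_rw [Finset.mul_sum]
  rw [Finset.sum_comm]
  refine Finset.sum_le_sum fun v _ => ?_
  rw [Finset.sum_comm]
  refine Finset.sum_le_sum fun u₁ _ => ?_
  rw [Finset.sum_comm]
  refine Finset.sum_le_sum fun u₂ _ => ?_
  rw [Finset.sum_comm]
  refine Finset.sum_le_sum fun c₁ _ => ?_
  rw [Finset.sum_comm]
  refine Finset.sum_le_sum fun c₂ hc₂ => ?_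
  simp_rw [mul_left_comm _ (Real.exp (2 * _))]
  rw [← Finset.mul_sum]
  refine mul_le_mul_of_nonneg_left ?_ (Real.exp_pos _).le
  refine (sum_damping_le hp hpq hq _ _).trans_eq ?_
  rw [Finset.card_pair (Finset.ne_of_mem_erase hc₂).symm]
  norm_num

open Classical in
lemma one_sub_coupleProb_le_of_card_le {p q M : ℝ} (hp : 0 ≤ p) (hpq : p ≤ q) (hq : q ≤ 1)
    (hM : ∀ u v : Fin n, u ≠ v → ((copiesAt H u ∩ copiesAt H v).card : ℝ) ≤ M) (hM0 : 0 ≤ M) :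
    1 - coupleProb H n p q SparselyCovered ≤
      n ^ 2 * (M ^ 2 * pairBound n p q (mr H n 1)) +
        n ^ 3 * (M ^ 2 * pairBound n p q (2 * mr H n 1 - M)) := by
  set E₁ := M ^ 2 * pairBound n p q (mr H n 1) with hE₁
  set E₂ := M ^ 2 * pairBound n p q (2 * mr H n 1 - M) with hE₂
  have hE₁0 : 0 ≤ E₁ := mul_nonneg (sq_nonneg _) (pairBound_nonneg _ _ _ _)
  have hE₂0 : 0 ≤ E₂ := mul_nonneg (sq_nonneg _) (pairBound_nonneg _ _ _ _)
  refine (one_sub_coupleProb_le hp hpq hq).trans ?_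
  trans ∑ _v : Fin n, ∑ u₁ : Fin n, ∑ u₂ : Fin n, ((if u₁ = u₂ then E₁ else 0) + E₂)
  · refine Finset.sum_le_sum fun v _ => ?_
    refine (Finset.sum_le_sum fun u₁ hu₁ => ?_).trans (Finset.sum_le_sum_of_subset_of_nonneg
      (Finset.erase_subset v _) fun _ _ _ => by positivity)
    refine (Finset.sum_le_sum fun u₂ hu₂ => ?_).trans (Finset.sum_le_sum_of_subset_of_nonneg
      (Finset.erase_subset v _) fun _ _ _ => by positivity)
    have hv₁ := hM v u₁ (Finset.ne_of_mem_erase hu₁).symm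
    have hv₂ := hM v u₂ (Finset.ne_of_mem_erase hu₂).symm
    have hle : ∑ c₁ ∈ copiesAt H v ∩ copiesAt H u₁,
        ∑ _c₂ ∈ (copiesAt H v ∩ copiesAt H u₂).erase c₁,
          pairBound n p q (copiesAt H u₁ ∪ copiesAt H u₂).card ≤
        M ^ 2 * pairBound n p q (copiesAt H u₁ ∪ copiesAt H u₂).card := by
      have hb := pairBound_nonneg n p q (copiesAt H u₁ ∪ copiesAt H u₂).card
      have hc : ∀ c₁, ∑ _c₂ ∈ (copiesAt H v ∩ copiesAt H u₂).erase c₁,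
          pairBound n p q (copiesAt H u₁ ∪ copiesAt H u₂).card ≤
          M * pairBound n p q (copiesAt H u₁ ∪ copiesAt H u₂).card := by
        intro c₁
        rw [Finset.sum_const, nsmul_eq_mul]
        refine mul_le_mul_of_nonneg_right (le_trans ?_ hv₂) hb
        exact_mod_cast Finset.card_erase_le
      refine (Finset.sum_le_sum fun c₁ _ => hc c₁).trans ?_
      rw [Finset.sum_const, nsmul_eq_mul, pow_two, mul_assoc]
      gcongr
    refine hle.trans ?_
    split_ifs with h
    · subst h
      rw [Finset.union_self, card_copiesAt_eq_mr]
      linarith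
    · rw [zero_add]
      refine mul_le_mul_of_nonneg_left (pairBound_anti hp n q ?_) (sq_nonneg M)
      have h₁ := Finset.card_union_add_card_inter (copiesAt H u₁) (copiesAt H u₂)
      rw [card_copiesAt_eq_mr, card_copiesAt_eq_mr] at h₁
      have h₂ := hM u₁ u₂ h
      have h₃ : ((copiesAt H u₁ ∪ copiesAt H u₂).card : ℝ) +
        (copiesAt H u₁ ∩ copiesAt H u₂).card = mr H n 1 + mr H n 1 := by exact_mod_cast h₁
      linarith
  · simp only [Finset.sum_add_distrib, Finset.sum_ite_eq, Finset.mem_univ, if_true,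
      Finset.sum_const, Finset.card_univ, Fintype.card_fin, nsmul_eq_mul]
    apply le_of_eq
    ring

end UnionBound

section Asymptotics

lemma tendsto_log_natCast : Tendsto (fun n : ℕ => Real.log n) atTop atTop :=
  Real.tendsto_log_atTop.comp tendsto_natCast_atTop_atTop

lemma tendsto_loglog_natCast : Tendsto (fun n : ℕ => Real.log (Real.log n)) atTop atTop :=
  Real.tendsto_log_atTop.comp tendsto_log_natCast

lemma eventually_mul_loglog_le_log (C : ℝ) :
    ∀ᶠ n : ℕ in atTop, C * Real.log (Real.log n) ≤ Real.log n := by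
  have h := (Real.isLittleO_log_id_atTop.comp_tendsto tendsto_log_natCast).bound
    (c := 1 / (|C| + 1)) (by positivity)
  filter_upwards [h, tendsto_log_natCast.eventually_ge_atTop 0,
    tendsto_loglog_natCast.eventually_ge_atTop 0] with n hn h0 h1
  simp only [Function.comp_apply, id, Real.norm_eq_abs, abs_of_nonneg h0, abs_of_nonneg h1] at hn
  rw [div_mul_eq_mul_div, one_mul, le_div_iff₀ (by positivity)] at hn
  nlinarith [le_abs_self C]

lemma eventually_mul_log_le (C : ℝ) : ∀ᶠ n : ℕ in atTop, C * Real.log n ≤ n := by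
  have h := (Real.isLittleO_log_id_atTop.comp_tendsto tendsto_natCast_atTop_atTop).bound
    (c := 1 / (|C| + 1)) (by positivity)
  filter_upwards [h, tendsto_log_natCast.eventually_ge_atTop 0] with n hn h0
  simp only [Function.comp_apply, id, Real.norm_eq_abs, abs_of_nonneg h0, Nat.abs_cast] at hn
  rw [div_mul_eq_mul_div, one_mul, le_div_iff₀ (by positivity)] at hn
  nlinarith [le_abs_self C]

lemma tendsto_log_pow_mul_exp_neg_log (j : ℕ) {a : ℝ} (ha : 0 < a) :
    Tendsto (fun n : ℕ => Real.log n ^ j * Real.exp (-(a * Real.log n))) atTop (nhds 0) := by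
  have h := (Real.tendsto_pow_mul_exp_neg_atTop_nhds_zero j).comp
    ((tendsto_id.const_mul_atTop ha).comp tendsto_log_natCast)
  have h' := h.const_mul ((a ^ j)⁻¹)
  rw [mul_zero] at h'
  refine h'.congr fun n => ?_
  simp only [Function.comp_apply, id, mul_pow]
  field_simp

end Asymptotics

section ParameterBounds

variable {k : ℕ} {H : SimpleGraph (Fin k)}

lemma deltad_two_le_one (H : SimpleGraph (Fin k)) : deltad H 2 ≤ 1 := by
  have h : ⌈((2 : ℕ) : ℝ) / (minDeg H : ℝ)⌉₊ ≤ 2 := by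
    rw [Nat.ceil_le]
    rcases Nat.eq_zero_or_pos (minDeg H) with h0 | h0
    · simp [h0]
    · exact div_le_self (by norm_num) (by exact_mod_cast h0)
  unfold deltad
  omega

lemma eventually_natCast_le_mul_mr (hk : 0 < k) (hiso : ∀ v, (H.neighborSet v).Nonempty) :
    ∀ᶠ n : ℕ in atTop, (n : ℝ) ≤ 2 * k * mr H n 1 := by
  filter_upwards [eventually_ge_atTop k] with n hkn
  have h2 := two_le_of_forall_neighborSet_nonempty hk hiso
  have h := pred_le_mul_mr hk hiso hkn
  have h' : (k - 1) * mr H n 1 ≤ k * mr H n 1 := Nat.mul_le_mul_right _ (Nat.sub_le _ _)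
  have : n ≤ 2 * (k * mr H n 1) := by omega
  rw [mul_assoc]
  exact_mod_cast this

open Classical in
lemma card_copiesAt_inter_le_div {n : ℕ} (hn : 2 ≤ n)
    (hiso : ∀ v, (H.neighborSet v).Nonempty) {u v : Fin n} (huv : u ≠ v) :
    ((copiesAt H u ∩ copiesAt H v).card : ℝ) ≤ 2 * k * mr H n 1 / n := by
  have h := pred_mul_card_copiesAt_inter (H := H) hiso huv
  have h' : (k - 1) * mr H n 1 ≤ k * mr H n 1 := Nat.mul_le_mul_right _ (Nat.sub_le _ _)
  rw [le_div_iff₀ (by positivity)]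
  have h2 : n ≤ 2 * (n - 1) := by omega
  have : (copiesAt H u ∩ copiesAt H v).card * n ≤ 2 * (k * mr H n 1) := by
    nlinarith [Nat.mul_le_mul_left (copiesAt H u ∩ copiesAt H v).card h2]
  rw [mul_assoc]
  exact_mod_cast this

lemma exp_neg_one_le : Real.exp (-1) ≤ 2 / 5 := by
  rw [Real.exp_neg, inv_le_comm₀ (Real.exp_pos _) (by norm_num)]
  linarith [Real.exp_one_gt_d9]

lemma pairBound_le {n : ℕ} {p q m a : ℝ} (hn : 0 < Real.log n)
    (h : a * Real.log n - 4 * Real.log (Real.log n) - 3 ≤ (1 - Real.exp (-1)) * p * (m - 2)) :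
    pairBound n p q m ≤
      q ^ 2 * (Real.exp 3 * (Real.log n ^ 6 * Real.exp (-(a * Real.log n)))) := by
  have hexp : ∀ j : ℕ, Real.exp (j * Real.log (Real.log n)) = Real.log n ^ j := fun j => by
    rw [Real.exp_nat_mul, Real.exp_log hn]
  have h2 := hexp 2
  have h4 := hexp 4
  push_cast at h2 h4
  have he : Real.exp (-((1 - Real.exp (-1)) * p * (m - 2))) ≤
      Real.exp (-(a * Real.log n)) * Real.log n ^ 4 * Real.exp 3 := by
    rw [← h4, ← Real.exp_add, ← Real.exp_add, Real.exp_le_exp]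
    linarith
  unfold pairBound
  rw [h2]
  calc Real.log n ^ 2 * (q ^ 2 * Real.exp (-((1 - Real.exp (-1)) * p * (m - 2))))
      ≤ Real.log n ^ 2 * (q ^ 2 *
          (Real.exp (-(a * Real.log n)) * Real.log n ^ 4 * Real.exp 3)) := by gcongr
    _ = _ := by ring

lemma eventually_one_sub_coupleProb_le (hk : 0 < k)
    (hiso : ∀ v, (H.neighborSet v).Nonempty)
    (x : ℕ → ℝ) (hx : Tendsto x atTop atTop)
    (hx' : Tendsto (fun n => x n / Real.log (Real.log n)) atTop (nhds 0)) :
    ∀ᶠ n : ℕ in atTop, coupleProb H n (pZero H n) (pPlus H 2 x n) SparselyCovered ≤ 1 ∧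
      1 - coupleProb H n (pZero H n) (pPlus H 2 x n) SparselyCovered ≤
        (72 * k ^ 2 * Real.exp 3) * (Real.log n ^ 8 * Real.exp (-(1 / 5 * Real.log n))) := by
  filter_upwards [eventually_natCast_le_mul_mr hk hiso, eventually_ge_atTop 2,
    hx.eventually_ge_atTop 0, hx'.eventually_le_const (zero_lt_one),
    tendsto_loglog_natCast.eventually_ge_atTop 1, eventually_mul_loglog_le_log 2,
    eventually_mul_log_le (6 * k)] with n hmr hn2 hx0 hx1 hll hlog hnlog
  set l := Real.log n with hl
  set t := Real.log l with ht
  set m := (mr H n 1 : ℝ) with hm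
  have hk1 : (1 : ℝ) ≤ k := by exact_mod_cast hk
  have hn : (0 : ℝ) < n := by positivity
  have hm0 : 0 < m := by
    by_contra! h
    nlinarith
  have hl0 : 0 < l := by linarith
  have hxt : x n ≤ t := by rwa [div_le_one (by linarith)] at hx1
  have hδ : (deltad H 2 : ℝ) ≤ 1 := by exact_mod_cast deltad_two_le_one H
  have hδ0 : (0 : ℝ) ≤ deltad H 2 := Nat.cast_nonneg _
  set p := pZero H n with hp
  set q := pPlus H 2 x n with hq
  have hpm : p * m = l - 2 * t := div_mul_cancel₀ _ hm0.ne'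
  have hqm : q * m = l + deltad H 2 * t + x n := div_mul_cancel₀ _ hm0.ne'
  have hqm3 : q * m ≤ 3 * l := by rw [hqm]; nlinarith
  have hm3 : 3 * l ≤ m := by
    have : 2 * k * (3 * l) ≤ 2 * k * m := by linarith
    exact le_of_mul_le_mul_left this (by positivity)
  have hp0 : 0 ≤ p := div_nonneg (by linarith) hm0.le
  have hpq : p ≤ q := by
    refine le_of_mul_le_mul_right ?_ hm0
    rw [hpm, hqm]
    nlinarith
  have hq0 : 0 ≤ q := hp0.trans hpq
  have hq1 : q ≤ 1 := le_of_mul_le_mul_right (by linarith) hm0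
  set M := 2 * k * m / n with hM
  have hM0 : 0 ≤ M := by positivity
  have hMn : M * n = 2 * k * m := div_mul_cancel₀ _ hn.ne'
  have hpM : p * M ≤ 1 := by
    refine le_of_mul_le_mul_right ?_ hn
    rw [mul_assoc, hMn, mul_left_comm, hpm]
    nlinarith
  have hMq : M ^ 2 * q ^ 2 * n ^ 2 ≤ 36 * k ^ 2 * l ^ 2 := by
    have h : M * q * n ≤ 6 * k * l := by
      calc M * q * n = 2 * k * (q * m) := by rw [mul_right_comm, hMn]; ring
        _ ≤ 2 * k * (3 * l) := by gcongr
        _ = _ := by ring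
    calc M ^ 2 * q ^ 2 * n ^ 2 = (M * q * n) ^ 2 := by ring
      _ ≤ (6 * k * l) ^ 2 := by gcongr
      _ = _ := by ring
  have hθ := exp_neg_one_le
  have hθ0 := Real.exp_pos (-1)
  refine ⟨coupleProb_le_one hp0 hpq hq1 _, ?_⟩
  refine (one_sub_coupleProb_le_of_card_le hp0 hpq hq1
    (fun u v huv => card_copiesAt_inter_le_div hn2 hiso huv) hM0).trans ?_
  have h₁ : pairBound n p q m ≤
      q ^ 2 * (Real.exp 3 * (l ^ 6 * Real.exp (-(3 / 5 * l)))) := by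
    refine pairBound_le hl0 ?_
    rw [mul_assoc, mul_sub, hpm]
    nlinarith
  have h₂ : pairBound n p q (2 * m - M) ≤
      q ^ 2 * (Real.exp 3 * (l ^ 6 * Real.exp (-(6 / 5 * l)))) := by
    refine pairBound_le hl0 ?_
    rw [mul_assoc, show p * (2 * m - M - 2) = 2 * (p * m) - (p * M + p * 2) by ring, hpm]
    nlinarith
  have he : (n : ℝ) * Real.exp (-(6 / 5 * l)) = Real.exp (-(1 / 5 * l)) := by
    nth_rewrite 1 [← Real.exp_log hn]
    rw [← Real.exp_add]
    congr 1
    linarith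
  have he' : Real.exp (-(3 / 5 * l)) ≤ Real.exp (-(1 / 5 * l)) :=
    Real.exp_le_exp.2 (by linarith)
  calc n ^ 2 * (M ^ 2 * pairBound n p q m) + n ^ 3 * (M ^ 2 * pairBound n p q (2 * m - M))
      ≤ n ^ 2 * (M ^ 2 * (q ^ 2 * (Real.exp 3 * (l ^ 6 * Real.exp (-(3 / 5 * l)))))) +
        n ^ 3 * (M ^ 2 * (q ^ 2 * (Real.exp 3 * (l ^ 6 * Real.exp (-(6 / 5 * l)))))) := by
        gcongr
    _ = M ^ 2 * q ^ 2 * n ^ 2 * (Real.exp 3 * l ^ 6 *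
          (Real.exp (-(3 / 5 * l)) + n * Real.exp (-(6 / 5 * l)))) := by ring
    _ ≤ 36 * k ^ 2 * l ^ 2 * (Real.exp 3 * l ^ 6 *
          (Real.exp (-(1 / 5 * l)) + Real.exp (-(1 / 5 * l)))) := by
        rw [he]
        gcongr
    _ = _ := by ring

end ParameterBounds

/-- **Lemma (SMALL is sparsely covered).**  Under the coupling
`G(H,n,p_0) ⊆ G(H,n,p_2^+)`, w.h.p. for every vertex `v` there is at most one copy
of `H` present in `G(H,n,p_2^+)` that contains `v` and also meets
`SMALL \ {v}` (with `SMALL` defined from `G(H,n,p_0)`). -/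
theorem small_sparsely_covered {r : ℕ} (H : SimpleGraph (Fin r)) (hr : 0 < r)
    (hiso : ∀ v, (H.neighborSet v).Nonempty)
    (x : ℕ → ℝ) (hx : Tendsto x atTop atTop)
    (hx' : Tendsto (fun n => x n / Real.log (Real.log n)) atTop (nhds 0)) :
    Tendsto (fun n => coupleProb H n (pZero H n) (pPlus H 2 x n)
      (fun ω₀ ω₂ => ∀ v : Fin n,
        {c : Copy H n | ω₂ c = true ∧ v ∈ c.1.support ∧
          ∃ u ∈ Small ω₀, u ≠ v ∧ u ∈ c.1.support}.Subsingleton))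
      atTop (nhds 1) := by
  have hev := eventually_one_sub_coupleProb_le hr hiso x hx hx'
  have hlim := (tendsto_log_pow_mul_exp_neg_log 8 (a := 1 / 5) (by norm_num)).const_mul
    (72 * (r : ℝ) ^ 2 * Real.exp 3)
  refine tendsto_of_tendsto_of_tendsto_of_le_of_le' (by simpa only [mul_zero, sub_zero] using hlim.const_sub 1)
    tendsto_const_nhds ?_ (hev.mono fun n hn => hn.1)
  exact hev.mono fun n hn => sub_le_comm.1 hn.2

end RandomMotif
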